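/- arXiv:math/0507121 — 9 statements merged into one kernel-verified Lean document; each statement's English description precedes it below -/
import Mathlib

section
/- The set of rational numbers of the form -(b+2)/(2a+2b), where a and b range over the positive even integers with a ≠ 2 (equivalently, a ≥ 4 even and b ≥ 2 even), is exactly the set of all rational numbers in the open interval (-1/2, 0). That is, {-(b+2)/(2a+2b) | a, b ∈ 2ℤ_{>0}, a ≠ 2} = ℚ ∩ (-1/2, 0). -/
/-- Lemma (Section 3): the set of rationals `-(b+2)/(2a+2b)` with `a, b`
positive even integers and `a ≠ 2` is exactly `ℚ ∩ (-1/2, 0)`. -/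
theorem stmt_0 :
    {q : ℚ | ∃ a b : ℤ, 0 < a ∧ 0 < b ∧ Even a ∧ Even b ∧ a ≠ 2 ∧
      q = -((b : ℚ) + 2) / (2 * (a : ℚ) + 2 * (b : ℚ))} =
    {q : ℚ | -(1 / 2) < q ∧ q < 0} := by
  ext q
  simp only [Set.mem_ofPred_eq]
  constructor
  · rintro ⟨a, b, ha, hb, ⟨c, rfl⟩, -, hne, rfl⟩
    have ha' : (2 : ℚ) < ((c + c : ℤ) : ℚ) := by
      exact_mod_cast (by omega : 2 < c + c)
    have hb' : (0 : ℚ) < b := by exact_mod_cast hb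
    have hpos : (0 : ℚ) < 2 * ((c + c : ℤ) : ℚ) + 2 * (b : ℚ) := by linarith
    constructor
    · rw [lt_div_iff₀ hpos]
      linarith
    · rw [div_lt_iff₀ hpos]
      linarith
  · rintro ⟨hlo, hhi⟩
    have hd : (0 : ℚ) < q.den := by exact_mod_cast q.den_pos
    have hq : (q.num : ℚ) = q * q.den := (Rat.mul_den_eq_num q).symm
    have hn : q.num < 0 := Rat.num_neg.mpr hhi
    have hnd : 0 < (q.den : ℤ) + 2 * q.num := by
      have : (0 : ℚ) < q.den + 2 * q.num := by
        rw [hq]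
        nlinarith
      exact_mod_cast this
    -- Write `q = -n / d`; then `b + 2 = 4 * n` and `a + b = 2 * d`.
    refine ⟨2 * (q.den + 2 * q.num) + 2, -4 * q.num - 2, by omega, by omega,
      ⟨q.den + 2 * q.num + 1, by ring⟩, ⟨-2 * q.num - 1, by ring⟩, by omega, ?_⟩
    push_cast
    rw [eq_div_iff (by linarith), hq]
    ring
end

section
/- For every integer n ≥ 3, the set of rational numbers of the form -(b+2)/(2a+2b) - (n-2)/2, where a and b range over the positive even integers with a ≠ 2, is exactly the set of all rational numbers in the open interval (-(n-1)/2, -(n-2)/2). That is, {-(b+2)/(2a+2b) - (n-2)/2 | a, b ∈ 2ℤ_{>0}, a ≠ 2} = ℚ ∩ (-(n-1)/2, -(n-2)/2). -/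
/-- Section 4 parametrization: for `n ≥ 3`, the set of rationals
`-(b+2)/(2a+2b) - (n-2)/2` with `a, b` positive even integers and `a ≠ 2`
is exactly `ℚ ∩ (-(n-1)/2, -(n-2)/2)`. -/
theorem stmt_1 (n : ℤ) (hn : 3 ≤ n) :
    {q : ℚ | ∃ a b : ℤ, 0 < a ∧ 0 < b ∧ Even a ∧ Even b ∧ a ≠ 2 ∧
      q = -((b : ℚ) + 2) / (2 * (a : ℚ) + 2 * (b : ℚ)) - ((n : ℚ) - 2) / 2} =
    {q : ℚ | -(((n : ℚ) - 1) / 2) < q ∧ q < -(((n : ℚ) - 2) / 2)} := by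
  ext q
  simp only [Set.mem_ofPred_eq]
  constructor
  · rintro ⟨a, b, ha, hb, hae, -, ha2, rfl⟩
    have ha3 : 2 < a := by
      obtain ⟨c, rfl⟩ := hae
      omega
    have haq : (2 : ℚ) < a := by exact_mod_cast ha3
    have hbq : (0 : ℚ) < b := by exact_mod_cast hb
    have hpos : 0 < ((b : ℚ) + 2) / (2 * a + 2 * b) := by positivity
    have hlt : ((b : ℚ) + 2) / (2 * a + 2 * b) < 1 / 2 := by
      rw [div_lt_div_iff₀ (by positivity) (by norm_num)]
      linarith
    rw [neg_div]
    constructor <;> linarith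
  · rintro ⟨h1, h2⟩
    obtain ⟨r, hr⟩ : ∃ r : ℚ, r = -2 * q - (n - 2) := ⟨_, rfl⟩
    have hr0 : 0 < r := by linarith
    have hr1 : r < 1 := by linarith
    have hp : 0 < r.num := Rat.num_pos.mpr hr0
    have hd : (0 : ℚ) < r.den := by exact_mod_cast r.den_pos
    have hnd : (r.num : ℚ) = r * r.den := (Rat.mul_den_eq_num r).symm
    have hlt : r.num < r.den := by
      have : (r.num : ℚ) < r.den := by
        rw [hnd]
        exact mul_lt_of_lt_one_left hd hr1
      exact_mod_cast this
    refine ⟨4 * (r.den - r.num) + 2, 4 * r.num - 2, by omega, by omega,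
      ⟨2 * (r.den - r.num) + 1, by ring⟩, ⟨2 * r.num - 1, by ring⟩, by omega, ?_⟩
    have hnum : ((4 * r.num - 2 : ℤ) : ℚ) + 2 = 4 * (r * r.den) := by
      push_cast
      rw [hnd]
      ring
    have hden : 2 * ((4 * (r.den - r.num) + 2 : ℤ) : ℚ) + 2 * ((4 * r.num - 2 : ℤ) : ℚ)
        = 8 * r.den := by
      push_cast
      ring
    have hfrac : -(4 * (r * r.den)) / (8 * (r.den : ℚ)) = -r / 2 := by
      field_simp
      norm_num
    rw [hnum, hden, hfrac]
    linarith
end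

section
/- For every integer n ≥ 2 and every rational number q with -(n-1)/2 ≤ q < 0, at least one of the following holds: (i) there exist an integer m with 2 ≤ m ≤ n and positive even integers a and b with a ≠ 2 such that q = -(b+2)/(2a+2b) - (m-2)/2; or (ii) there exist an integer m with 1 ≤ m ≤ n-1 and an integer i ≥ 2 such that q = -(m-1)/2 - 1/i. -/
/-- Arithmetic covering statement underlying the main Theorem: every rational
`q` with `-(n-1)/2 ≤ q < 0` is of one of the two explicit forms. -/
theorem stmt_2 (n : ℤ) (hn : 2 ≤ n) (q : ℚ)
    (hq₁ : -(((n : ℚ) - 1) / 2) ≤ q) (hq₂ : q < 0) :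
    (∃ m a b : ℤ, 2 ≤ m ∧ m ≤ n ∧ 0 < a ∧ 0 < b ∧ Even a ∧ Even b ∧ a ≠ 2 ∧
      q = -((b : ℚ) + 2) / (2 * (a : ℚ) + 2 * (b : ℚ)) - ((m : ℚ) - 2) / 2) ∨
    (∃ m i : ℤ, 1 ≤ m ∧ m ≤ n - 1 ∧ 2 ≤ i ∧
      q = -(((m : ℚ) - 1) / 2) - 1 / (i : ℚ)) := by
  obtain ⟨k, hk⟩ : ∃ k : ℤ, k = ⌈-2 * q⌉ := ⟨_, rfl⟩
  have hk_ge : -2 * q ≤ k := hk ▸ Int.le_ceil _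
  have hk_lt : (k : ℚ) < -2 * q + 1 := hk ▸ Int.ceil_lt_add_one _
  have hk_pos : 1 ≤ k := by
    rw [hk, Int.one_le_ceil_iff]
    linarith
  have hk_le : k ≤ n - 1 := by
    rw [hk, Int.ceil_le]
    push_cast
    linarith
  rcases hk_ge.eq_or_lt with h | h
  · refine Or.inr ⟨k, 2, hk_pos, hk_le, le_rfl, ?_⟩
    push_cast
    linarith
  · obtain ⟨s, hs⟩ : ∃ s : ℚ, s = -2 * q - (k - 1) := ⟨_, rfl⟩
    have hu : 0 < s.num := Rat.num_pos.mpr (by linarith)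
    have huv : s.num < s.den := Rat.num_lt_denom_iff.mpr (by linarith)
    refine Or.inl ⟨k + 1, 4 * (s.den - s.num) + 2, 4 * s.num - 2, by lia, by lia, by lia, by lia,
      ⟨2 * (s.den - s.num) + 1, by ring⟩, ⟨2 * s.num - 1, by ring⟩, by lia, ?_⟩
    have hden : (s.den : ℚ) ≠ 0 := by exact_mod_cast s.den_ne_zero
    have hfrac : -((4 * s.num - 2 : ℚ) + 2) /
        (2 * (4 * (s.den - s.num) + 2) + 2 * (4 * s.num - 2)) = -(s / 2) := by
      conv_rhs => rw [← Rat.num_div_den s]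
      rw [show (2 * (4 * (s.den - s.num) + 2) + 2 * (4 * s.num - 2) : ℚ) = 8 * s.den by ring]
      field_simp
      ring
    push_cast
    rw [hfrac]
    linarith
end

section
/- Let n ≥ 4 be an even integer and let i ≥ 4 be an even integer. Set α₀ = (3-n)/2 - 1/i and α = 2/i. Then α₀ ≠ 0, α ≠ 0, and (1/i)·(-1 + 1/α + 2/α₀ + (n-2)/(α₀·α)) ≠ 0. -/
/-- Section 2 residue nonvanishing, `i` even, `n` even. -/
theorem stmt_4 (n i : ℤ) (hn : 4 ≤ n) (hne : Even n) (hi : 4 ≤ i) (hie : Even i)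
    (α₀ α : ℚ) (hα₀ : α₀ = ((3 : ℚ) - n) / 2 - 1 / (i : ℚ)) (hα : α = 2 / (i : ℚ)) :
    α₀ ≠ 0 ∧ α ≠ 0 ∧
      (1 / (i : ℚ)) * (-1 + 1 / α + 2 / α₀ + ((n : ℚ) - 2) / (α₀ * α)) ≠ 0 := by
  have hn' : (4 : ℚ) ≤ n := by exact_mod_cast hn
  have hi' : (4 : ℚ) ≤ i := by exact_mod_cast hi
  have hi_pos : (0 : ℚ) < i := by linarith
  have hα₀_neg : α₀ < 0 := by
    have : (0 : ℚ) < 1 / i := by positivity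
    linarith
  have hα_pos : 0 < α := by rw [hα]; positivity
  refine ⟨hα₀_neg.ne, hα_pos.ne', mul_ne_zero (by positivity) fun h => ?_⟩
  have hα₀_ne := hα₀_neg.ne
  have hα_ne := hα_pos.ne'
  have hcleared : -(α₀ * α) + α₀ + 2 * α + (n - 2) = 0 := by
    field_simp at h
    linear_combination h
  have hvalue : (-(α₀ * α) + α₀ + 2 * α + (n - 2)) * (2 * i ^ 2)
      = i ^ 2 * (n - 1) + 2 * n * i + 4 := by
    rw [hα₀, hα]
    field_simp
    ring
  rw [hcleared, zero_mul] at hvalue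
  have : (0 : ℚ) < i ^ 2 * (n - 1) := mul_pos (by positivity) (by linarith)
  have : (0 : ℚ) < n * i := mul_pos (by linarith) hi_pos
  linarith
end

section
/- Let n ≥ 4 be an even integer and let i ≥ 3 be an odd integer. Set α₀ = (3-n)/2 - 1/i, α₁ = 1/i and α₂ = (n-1)/2. Then α₀ ≠ 0 and (1/(2i))·(-1 + 1/α₀ + (n-1)/α₂ + 1/α₁ + (n-2)/(α₁·α₀)) ≠ 0. -/
/-- Section 2 residue nonvanishing, `i` odd, `n` even. -/
theorem stmt_6 (n i : ℤ) (hn : 4 ≤ n) (hne : Even n) (hi : 3 ≤ i) (hio : Odd i)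
    (α₀ α₁ α₂ : ℚ) (hα₀ : α₀ = ((3 : ℚ) - n) / 2 - 1 / (i : ℚ))
    (hα₁ : α₁ = 1 / (i : ℚ)) (hα₂ : α₂ = ((n : ℚ) - 1) / 2) :
    α₀ ≠ 0 ∧
      (1 / (2 * (i : ℚ))) *
        (-1 + 1 / α₀ + ((n : ℚ) - 1) / α₂ + 1 / α₁ + ((n : ℚ) - 2) / (α₁ * α₀)) ≠ 0 := by
  have hn' : (4 : ℚ) ≤ n := by exact_mod_cast hn
  have hi' : (3 : ℚ) ≤ i := by exact_mod_cast hi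
  generalize (n : ℚ) = m at *
  generalize (i : ℚ) = j at *
  have hj : j ≠ 0 := by positivity
  have hm : m - 1 ≠ 0 := by linarith
  have hD : j * (3 - m) - 2 ≠ 0 := by nlinarith
  have h₀ : α₀ = (j * (3 - m) - 2) / (2 * j) := by
    rw [hα₀]
    field_simp
  have key : -1 + 1 / α₀ + (m - 1) / α₂ + 1 / α₁ + (m - 2) / (α₁ * α₀) =
      (j - 1) * ((m - 1) * j + 2) / (j * (3 - m) - 2) := by
    rw [h₀, hα₁, hα₂]
    field_simp
    ring
  refine ⟨h₀ ▸ div_ne_zero hD (by positivity), ?_⟩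
  rw [key]
  have h₁ : j - 1 ≠ 0 := by linarith
  have h₂ : (m - 1) * j + 2 ≠ 0 := by nlinarith
  exact mul_ne_zero (by positivity) (div_ne_zero (mul_ne_zero h₁ h₂) hD)
end

section
/- Let n ≥ 3 be an odd integer and let a and b be positive even integers with a ≠ 2. Set α₀ = -((n-4)a + (n-3)b + 2)/(2(a+b)) and α₁ = (2-a)/(a+b). Then α₀ ≠ 0, α₁ ≠ 0, and (1/(a+b))·(1 + (n-1)/(α₀·α₁)) = ((-2+3a+2b)(na-2a-b+nb+2)) / ((-2+a)(a+b)(na-4a+2+nb-3b)); moreover this common value is nonzero. -/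
/-- Section 4 residue computation, `n` odd. -/
theorem stmt_7 (n a b : ℤ) (hn : 3 ≤ n) (hno : Odd n)
    (ha : 0 < a) (hb : 0 < b) (hae : Even a) (hbe : Even b) (ha2 : a ≠ 2)
    (α₀ α₁ : ℚ)
    (hα₀ : α₀ = -((((n : ℚ) - 4) * a + ((n : ℚ) - 3) * b + 2)) / (2 * ((a : ℚ) + b)))
    (hα₁ : α₁ = ((2 : ℚ) - a) / ((a : ℚ) + b)) :
    α₀ ≠ 0 ∧ α₁ ≠ 0 ∧
      (1 / ((a : ℚ) + b)) * (1 + ((n : ℚ) - 1) / (α₀ * α₁)) =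
        ((-2 + 3 * (a : ℚ) + 2 * b) * ((n : ℚ) * a - 2 * a - b + n * b + 2)) /
          ((-2 + (a : ℚ)) * ((a : ℚ) + b) *
            ((n : ℚ) * a - 4 * a + 2 + n * b - 3 * b)) ∧
      (1 / ((a : ℚ) + b)) * (1 + ((n : ℚ) - 1) / (α₀ * α₁)) ≠ 0 := by
  have hS : (a : ℚ) + b ≠ 0 := by exact_mod_cast (by omega : a + b ≠ 0)
  have hA : (-2 : ℚ) + a ≠ 0 := by exact_mod_cast (by omega : -2 + a ≠ 0)
  have hA' : (2 : ℚ) - a ≠ 0 := fun h => hA (by linarith)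
  have hDZ : n * a - 4 * a + 2 + n * b - 3 * b ≠ 0 := by
    obtain ⟨k, rfl⟩ := hno
    obtain rfl | hk : k = 1 ∨ 2 ≤ k := by omega
    · omega
    · nlinarith [mul_nonneg (sub_nonneg.2 hk) ha.le, mul_nonneg (sub_nonneg.2 hk) hb.le]
  have hD : (n : ℚ) * a - 4 * a + 2 + n * b - 3 * b ≠ 0 := by exact_mod_cast hDZ
  have hP : (-2 : ℚ) + 3 * a + 2 * b ≠ 0 := by
    exact_mod_cast (by omega : -2 + 3 * a + 2 * b ≠ 0)
  have hQZ : n * a - 2 * a - b + n * b + 2 ≠ 0 := by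
    nlinarith [mul_nonneg (sub_nonneg.2 hn) ha.le, mul_nonneg (sub_nonneg.2 hn) hb.le]
  have hQ : (n : ℚ) * a - 2 * a - b + n * b + 2 ≠ 0 := by exact_mod_cast hQZ
  have h₀ : α₀ = -((n : ℚ) * a - 4 * a + 2 + n * b - 3 * b) / (2 * ((a : ℚ) + b)) := by
    rw [hα₀]; ring
  have h₁ : α₁ = -((-2 : ℚ) + a) / ((a : ℚ) + b) := by rw [hα₁]; ring
  have key : (1 / ((a : ℚ) + b)) * (1 + ((n : ℚ) - 1) / (α₀ * α₁)) =
      ((-2 + 3 * (a : ℚ) + 2 * b) * ((n : ℚ) * a - 2 * a - b + n * b + 2)) /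
        ((-2 + (a : ℚ)) * ((a : ℚ) + b) *
          ((n : ℚ) * a - 4 * a + 2 + n * b - 3 * b)) := by
    rw [h₀, h₁]
    generalize hDe : (n : ℚ) * a - 4 * a + 2 + n * b - 3 * b = D at hD ⊢
    field_simp
    rw [← hDe]
    ring
  refine ⟨?_, ?_, key, ?_⟩
  · rw [h₀]
    exact div_ne_zero (neg_ne_zero.2 hD) (mul_ne_zero two_ne_zero hS)
  · rw [hα₁]
    exact div_ne_zero hA' hS
  · rw [key]
    exact div_ne_zero (mul_ne_zero hP hQ) (mul_ne_zero (mul_ne_zero hA hS) hD)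
end

section
/- Let n ≥ 4 be an even integer and let a and b be positive even integers with a ≠ 2. Set α₀ = -((n-4)a + (n-3)b + 2)/(2(a+b)) and α₁ = (2-a)/(a+b). Then α₀ ≠ 0, α₁ ≠ 0, and (1/(a+b))·(-1 + 1/α₁ + 2/α₀ + (n-2)/(α₀·α₁)) = ((2+b)(na-2a-b+nb+2)) / ((-2+a)(a+b)(na-4a+2+nb-3b)); moreover this common value is nonzero. -/
/-- Section 4 residue computation, `n` even. -/
theorem stmt_8 (n a b : ℤ) (hn : 4 ≤ n) (hne : Even n)
    (ha : 0 < a) (hb : 0 < b) (hae : Even a) (hbe : Even b) (ha2 : a ≠ 2)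
    (α₀ α₁ : ℚ)
    (hα₀ : α₀ = -((((n : ℚ) - 4) * a + ((n : ℚ) - 3) * b + 2)) / (2 * ((a : ℚ) + b)))
    (hα₁ : α₁ = ((2 : ℚ) - a) / ((a : ℚ) + b)) :
    α₀ ≠ 0 ∧ α₁ ≠ 0 ∧
      (1 / ((a : ℚ) + b)) * (-1 + 1 / α₁ + 2 / α₀ + ((n : ℚ) - 2) / (α₀ * α₁)) =
        ((2 + (b : ℚ)) * ((n : ℚ) * a - 2 * a - b + n * b + 2)) /
          ((-2 + (a : ℚ)) * ((a : ℚ) + b) *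
            ((n : ℚ) * a - 4 * a + 2 + n * b - 3 * b)) ∧
      (1 / ((a : ℚ) + b)) * (-1 + 1 / α₁ + 2 / α₀ + ((n : ℚ) - 2) / (α₀ * α₁)) ≠ 0 := by
  have hn' : (4 : ℚ) ≤ n := by exact_mod_cast hn
  have ha' : (0 : ℚ) < a := by exact_mod_cast ha
  have hb' : (0 : ℚ) < b := by exact_mod_cast hb
  have ha2' : (a : ℚ) ≠ 2 := by exact_mod_cast ha2
  have hS : (a : ℚ) + b ≠ 0 := by positivity
  have hA : (2 : ℚ) - a ≠ 0 := sub_ne_zero.mpr ha2'.symm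
  have hA' : -2 + (a : ℚ) ≠ 0 := fun h => ha2' (by linarith)
  have hna : 0 ≤ ((n : ℚ) - 4) * a := mul_nonneg (by linarith) ha'.le
  have hnb : 0 ≤ ((n : ℚ) - 4) * b := mul_nonneg (by linarith) hb'.le
  have hD : ((n : ℚ) - 4) * a + ((n : ℚ) - 3) * b + 2 ≠ 0 := by
    apply ne_of_gt
    linarith
  have hD' : (n : ℚ) * a - 4 * a + 2 + n * b - 3 * b ≠ 0 := by
    apply ne_of_gt
    linarith
  have hN : (n : ℚ) * a - 2 * a - b + n * b + 2 ≠ 0 := by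
    apply ne_of_gt
    linarith
  have hb2 : 2 + (b : ℚ) ≠ 0 := by positivity
  have hα₀_ne : α₀ ≠ 0 := by
    rw [hα₀]
    exact div_ne_zero (neg_ne_zero.mpr hD) (mul_ne_zero two_ne_zero hS)
  have hα₁_ne : α₁ ≠ 0 := by
    rw [hα₁]
    exact div_ne_zero hA hS
  have key : (1 / ((a : ℚ) + b)) * (-1 + 1 / α₁ + 2 / α₀ + ((n : ℚ) - 2) / (α₀ * α₁)) =
      ((2 + (b : ℚ)) * ((n : ℚ) * a - 2 * a - b + n * b + 2)) /
        ((-2 + (a : ℚ)) * ((a : ℚ) + b) *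
          ((n : ℚ) * a - 4 * a + 2 + n * b - 3 * b)) := by
    have h₀ : α₀ = -((n : ℚ) * a - 4 * a + 2 + n * b - 3 * b) / (2 * ((a : ℚ) + b)) := by
      rw [hα₀]
      ring
    have h₁ : α₁ = -(-2 + (a : ℚ)) / ((a : ℚ) + b) := by
      rw [hα₁]
      ring
    rw [h₀, h₁]
    generalize hd : (n : ℚ) * a - 4 * a + 2 + n * b - 3 * b = d at hD' ⊢
    field_simp
    rw [← hd]
    ring
  refine ⟨hα₀_ne, hα₁_ne, key, ?_⟩
  rw [key]
  exact div_ne_zero (mul_ne_zero hb2 hN) (mul_ne_zero (mul_ne_zero hA' hS) hD')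
end

section
/- Let n ≥ 3 be an integer and let a and b be positive even integers with a ≠ 2. Define the rational functions A(s) = (a+b)s + 1 + b/2 + (n-2)(a+b)/2 and B(s) = a·s + 1 + (n-2)a/2, and define Z(s) = (n-1)·b/(2A(s)B(s)) + 1/A(s) + (n-2)·a/(2B(s)) + (s/(s+1))·[ Σ_{d=1}^{n-1} binom(n-2, d+1)·(a/(2B(s)) + b/(2A(s)B(s)))·(-2)^d + Σ_{d=1}^{n-1} binom(n-1, d)·(1/A(s))·(-2)^d + Σ_{d=1}^{n-2} binom(n-2, d)·(b/(2A(s)B(s)))·(-2)^d ]. Set s₀ = -(b+2)/(2a+2b) - (n-2)/2. Then A(s₀) = 0, B(s₀) ≠ 0, s₀ ≠ 0, s₀ ≠ -1, and the limit as s → s₀ of (s - s₀)·Z(s) is nonzero; in particular Z has a pole at s₀. -/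
open Filter

theorem sum_Icc_choose_mul_neg_two_pow (m : ℕ) :
    ∑ d ∈ Finset.Icc 1 m, (m.choose d : ℚ) * (-2) ^ d = (-1) ^ m - 1 := by
  have h := add_pow (-2 : ℚ) 1 m
  rw [Finset.sum_range_succ'] at h
  rw [← Finset.Ico_add_one_right_eq_Icc, Finset.sum_Ico_eq_sum_range]
  norm_num at h ⊢
  rw [h]
  simp [mul_comm, add_comm]

theorem sum_Icc_choose_succ_mul_neg_two_pow (m : ℕ) :
    ∑ d ∈ Finset.Icc 1 (m + 1), (m.choose (d + 1) : ℚ) * (-2) ^ d =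
      (1 - (-1) ^ m - 2 * m) / 2 := by
  have h := sum_Icc_choose_mul_neg_two_pow m
  have hext : ∑ d ∈ Finset.Icc 1 m, (m.choose d : ℚ) * (-2) ^ d =
      ∑ d ∈ Finset.Icc 1 (m + 2), (m.choose d : ℚ) * (-2) ^ d := by
    apply Finset.sum_subset (Finset.Icc_subset_Icc_right (by omega))
    intro d hd hd'
    rw [Nat.choose_eq_zero_of_lt (by simp at hd hd'; omega)]
    simp
  rw [hext, ← Finset.Ico_add_one_right_eq_Icc, Finset.sum_Ico_eq_sum_range,
    Nat.add_sub_cancel, Finset.sum_range_succ'] at h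
  rw [← Finset.Ico_add_one_right_eq_Icc, Finset.sum_Ico_eq_sum_range, Nat.add_sub_cancel]
  have hshift : ∑ k ∈ Finset.range (m + 1), (m.choose (1 + (k + 1)) : ℚ) * (-2) ^ (1 + (k + 1)) =
      -2 * ∑ k ∈ Finset.range (m + 1), (m.choose (1 + k + 1) : ℚ) * (-2) ^ (1 + k) := by
    rw [Finset.mul_sum]
    refine Finset.sum_congr rfl fun k _ => ?_
    rw [← add_assoc, pow_succ]
    ring
  rw [hshift] at h
  norm_num at h
  linarith

/-- Remark (1) of Section 5: the explicit Newton-polyhedron formula `Z(s)` for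
the topological zeta function of `x_n^2 + ⋯ + x_3^2 + x_1^a(x_1^b + x_2^2)`
has a pole at `s₀ = -(b+2)/(2a+2b) - (n-2)/2`. -/
theorem stmt_9 (n : ℕ) (a b : ℤ) (hn : 3 ≤ n)
    (ha : 0 < a) (hb : 0 < b) (hae : Even a) (hbe : Even b) (ha2 : a ≠ 2)
    (A B Z : ℚ → ℚ) (s₀ : ℚ)
    (hA : ∀ s, A s = ((a : ℚ) + b) * s + 1 + (b : ℚ) / 2 + ((n : ℚ) - 2) * ((a : ℚ) + b) / 2)
    (hB : ∀ s, B s = (a : ℚ) * s + 1 + ((n : ℚ) - 2) * (a : ℚ) / 2)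
    (hZ : ∀ s, Z s =
      ((n : ℚ) - 1) * b / (2 * A s * B s) + 1 / A s + ((n : ℚ) - 2) * a / (2 * B s) +
        (s / (s + 1)) *
          ((∑ d ∈ Finset.Icc 1 (n - 1),
              ((n - 2).choose (d + 1) : ℚ) *
                ((a : ℚ) / (2 * B s) + (b : ℚ) / (2 * A s * B s)) * (-2) ^ d) +
            (∑ d ∈ Finset.Icc 1 (n - 1),
              ((n - 1).choose d : ℚ) * (1 / A s) * (-2) ^ d) +
            (∑ d ∈ Finset.Icc 1 (n - 2),
              ((n - 2).choose d : ℚ) * ((b : ℚ) / (2 * A s * B s)) * (-2) ^ d)))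
    (hs₀ : s₀ = -((b : ℚ) + 2) / (2 * (a : ℚ) + 2 * (b : ℚ)) - ((n : ℚ) - 2) / 2) :
    A s₀ = 0 ∧ B s₀ ≠ 0 ∧ s₀ ≠ 0 ∧ s₀ ≠ -1 ∧
      ∃ L : ℚ, L ≠ 0 ∧
        Tendsto (fun s => (s - s₀) * Z s) (nhdsWithin s₀ {s₀}ᶜ) (nhds L) := by
  obtain ⟨m, rfl⟩ : ∃ m, n = m + 2 := ⟨n - 2, by omega⟩
  have hm : (1 : ℚ) ≤ m := by exact_mod_cast (by omega : 1 ≤ m)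
  have ha4 : (4 : ℚ) ≤ a := by
    obtain ⟨k, rfl⟩ := hae
    exact_mod_cast (by omega : 4 ≤ k + k)
  have hb0 : (0 : ℚ) < b := by exact_mod_cast hb
  have hc0 : (0 : ℚ) < a + b := by linarith
  have hcne : (a : ℚ) + b ≠ 0 := hc0.ne'
  have h2a : (2 : ℚ) - a ≠ 0 := by linarith
  have hm2 : ((m + 2 : ℕ) : ℚ) - 2 = m := by push_cast; ring
  have hm1 : ((m + 2 : ℕ) : ℚ) - 1 = m + 1 := by push_cast; ring
  simp only [hm2, hm1, show m + 2 - 2 = m from rfl, show m + 2 - 1 = m + 1 from rfl] at *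
  have hs₀c : 2 * (a + b) * s₀ = -(b + 2) - m * (a + b) := by
    rw [hs₀]; field_simp
  have hA' : ∀ s, A s = (a + b) * (s - s₀) := fun s => by
    rw [hA]; linear_combination hs₀c / 2
  have hBs₀ : 2 * (a + b) * B s₀ = b * (2 - a) := by
    rw [hB]; linear_combination (a : ℚ) * hs₀c
  have hB0 : B s₀ ≠ 0 := fun h => by
    rw [h, mul_zero] at hBs₀
    exact mul_ne_zero hb0.ne' h2a hBs₀.symm
  have hs₀neg : s₀ < 0 := by nlinarith
  have hs₀1 : s₀ ≠ -1 := by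
    rintro rfl
    rcases (show m = 1 ∨ 2 ≤ m by omega) with rfl | h
    · norm_num at hs₀c
      linarith
    · have : (2 : ℚ) ≤ m := by exact_mod_cast h
      nlinarith
  have hs1 : s₀ + 1 ≠ 0 := fun h => hs₀1 (by linarith)
  refine ⟨by rw [hA', sub_self, mul_zero], hB0, hs₀neg.ne, hs₀1, ?_⟩
  set e : ℚ := (-1) ^ m with he
  let G : ℚ → ℚ := fun s =>
    (m + 1) * b / (2 * (a + b) * B s) + 1 / (a + b) + (s - s₀) * (m * a / (2 * B s)) +
      s / (s + 1) * ((1 - e - 2 * m) / 2 * ((s - s₀) * (a / (2 * B s)) + b / (2 * (a + b) * B s)) +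
        (-e - 1) * (1 / (a + b)) + (e - 1) * (b / (2 * (a + b) * B s)))
  have hGZ : ∀ s, s ≠ s₀ → (s - s₀) * Z s = G s := fun s hs => by
    have hss : s - s₀ ≠ 0 := sub_ne_zero.mpr hs
    have hS₁ := sum_Icc_choose_succ_mul_neg_two_pow m
    have hS₂ := sum_Icc_choose_mul_neg_two_pow (m + 1)
    have hS₃ := sum_Icc_choose_mul_neg_two_pow m
    rw [pow_succ] at hS₂
    rw [← he] at hS₁ hS₂ hS₃
    rw [hZ]
    simp only [mul_right_comm _ _ ((-2 : ℚ) ^ _)]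
    rw [← Finset.sum_mul, ← Finset.sum_mul, ← Finset.sum_mul, hS₁, hS₂, hS₃, hA']
    simp only [G, div_eq_mul_inv, mul_inv]
    generalize (B s)⁻¹ = u
    generalize (s + 1)⁻¹ = v
    field_simp
  have hGc : ContinuousAt G s₀ := by
    have hBc : ContinuousAt B s₀ := by
      rw [funext hB]; fun_prop
    have h2B : 2 * B s₀ ≠ 0 := mul_ne_zero two_ne_zero hB0
    have h2cB : 2 * (a + b) * B s₀ ≠ 0 := mul_ne_zero (mul_ne_zero two_ne_zero hcne) hB0
    fun_prop (disch := assumption)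
  refine ⟨G s₀, ?_, (hGc.tendsto.mono_left nhdsWithin_le_nhds).congr' ?_⟩
  · have hq : b / (2 * (a + b) * B s₀) = 1 / (2 - a) := by
      rw [hBs₀]; field_simp
    have hq' : (m + 1) * b / (2 * (a + b) * B s₀) = (m + 1) / (2 - a) := by
      rw [hBs₀]; field_simp
    have hG : G s₀ * ((a + b) * (s₀ + 1) * (2 - a)) =
        (s₀ + 1) * ((m + 1) * (a + b) + (2 - a)) +
          s₀ * ((e - 1 - 2 * m) / 2 * (a + b) - (1 + e) * (2 - a)) := by
      simp only [G, hq, hq', sub_self, zero_mul]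
      field_simp
      ring
    intro h
    rw [h, zero_mul] at hG
    rcases neg_one_pow_eq_or ℚ m with h1 | h1 <;> rw [← he] at h1 <;> rw [h1] at hG
    · have : (b + 2) * s₀ = 0 := by
        linear_combination hG + hs₀c
      nlinarith
    · nlinarith
  · filter_upwards [self_mem_nhdsWithin] with s hs
    exact (hGZ s hs).symm
end

section
/- Let n ≥ 3 be an integer and let a and b be positive even integers with a ≠ 2. Define numerical data as follows: for k ∈ {1, …, a/2}, set N_k = 2k and ν_k = (n-2)k + 1; and for j ∈ {1, …, b/2}, set N_{a/2+j} = a + 2j and ν_{a/2+j} = (n-2)(a/2 + j) + j + 1. Then for every index l ∈ {1, …, (a+b)/2}, the equality ν_l / N_l = ν_{(a+b)/2} / N_{(a+b)/2} holds if and only if l = (a+b)/2 or l·(b+2) = a+b. -/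
/-- Section 4: among the numerical data `(N_l, ν_l)` of the embedded resolution
of `x_n^2 + ⋯ + x_3^2 + x_1^a(x_1^b + x_2^2)`, an index `l` gives the same
candidate pole as `l = (a+b)/2` iff `l = (a+b)/2` or `l(b+2) = a+b`. -/
theorem stmt_10 (n a b : ℕ) (hn : 3 ≤ n)
    (ha : 0 < a) (hb : 0 < b) (hae : Even a) (hbe : Even b) (ha2 : a ≠ 2)
    (N ν : ℕ → ℚ)
    (h₁ : ∀ k, 1 ≤ k → k ≤ a / 2 →
      N k = 2 * (k : ℚ) ∧ ν k = ((n : ℚ) - 2) * k + 1)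
    (h₂ : ∀ j, 1 ≤ j → j ≤ b / 2 →
      N (a / 2 + j) = (a : ℚ) + 2 * (j : ℚ) ∧
        ν (a / 2 + j) = ((n : ℚ) - 2) * ((a : ℚ) / 2 + j) + j + 1) :
    ∀ l, 1 ≤ l → l ≤ (a + b) / 2 →
      (ν l / N l = ν ((a + b) / 2) / N ((a + b) / 2) ↔
        l = (a + b) / 2 ∨ l * (b + 2) = a + b) := by
  obtain ⟨c, rfl⟩ := hae
  obtain ⟨d, rfl⟩ := hbe
  have hc2 : (c + c) / 2 = c := by omega
  have hd2 : (d + d) / 2 = d := by omega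
  have hcd2 : (c + c + (d + d)) / 2 = c + d := by omega
  rw [hc2] at h₁ h₂
  rw [hd2] at h₂
  rw [hcd2]
  have hc : 2 ≤ c := by omega
  have hd : 1 ≤ d := by omega
  have hcd : ((c : ℚ) + d) ≠ 0 := by positivity
  obtain ⟨hN, hν⟩ := h₂ d hd le_rfl
  have hlast : ν (c + d) / N (c + d) =
      ((n : ℚ) - 2) / 2 + ((d : ℚ) + 1) / (2 * (c + d)) := by
    rw [hN, hν]
    push_cast
    have hden : (c : ℚ) + c + 2 * d ≠ 0 := by positivity
    field_simp
    ring
  intro l hl hlu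
  rw [hlast]
  rcases le_or_gt l c with hlc | hlc
  · obtain ⟨hNl, hνl⟩ := h₁ l hl hlc
    have hl0 : (l : ℚ) ≠ 0 := by positivity
    have hratio : ν l / N l = ((n : ℚ) - 2) / 2 + 1 / (2 * (l : ℚ)) := by
      rw [hNl, hνl]
      field_simp
    rw [hratio, add_right_inj, div_eq_div_iff (by positivity) (by positivity)]
    constructor
    · intro h
      right
      have h' : 1 * (2 * (c + d)) = (d + 1) * (2 * l) := by exact_mod_cast h
      linarith
    · rintro (h | h)
      · omega
      · have h' : (l : ℚ) * (d + d + 2) = c + c + (d + d) := by exact_mod_cast h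
        linarith
  · obtain ⟨j, rfl⟩ := Nat.exists_eq_add_of_lt hlc
    rw [add_assoc] at *
    obtain ⟨hNl, hνl⟩ := h₂ (j + 1) (by omega) (by omega)
    have hratio : ν (c + (j + 1)) / N (c + (j + 1)) =
        ((n : ℚ) - 2) / 2 + ((j : ℚ) + 2) / (2 * (c + (j + 1))) := by
      rw [hNl, hνl]
      push_cast
      have hden : (c : ℚ) + c + 2 * (j + 1) ≠ 0 := by positivity
      field_simp
      ring
    rw [hratio, add_right_inj, div_eq_div_iff (by positivity) (by positivity)]
    constructor
    · intro h
      left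
      have hc1 : (c : ℚ) - 1 ≠ 0 := by
        have : (2 : ℚ) ≤ c := by exact_mod_cast hc
        linarith
      have h' : (j : ℚ) + 1 = d := mul_right_cancel₀ hc1 (by linarith)
      have : j + 1 = d := by exact_mod_cast h'
      omega
    · rintro (h | h)
      · obtain rfl : d = j + 1 := by omega
        push_cast
        ring
      · nlinarith [Nat.mul_le_mul hc hd, Nat.mul_le_mul_right d hc, Nat.zero_le (j * d)]
end
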